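/- The class FSIAS has a 0–1 law: for every first-order sentence σ in the signature with one unary function symbol f, one unary relation symbol I, and one ternary relation symbol T, the limit as n → ∞ of the fraction of FSIAS structures with universe {1,…,n} that satisfy σ exists and is equal to 0 or 1. -/

import Mathlib

open Filter Topology FirstOrder

/-- Function symbols of the signature `{f, I, T}`: one unary function `f`. -/
inductive FASFunc : ℕ → Type
  | f : FASFunc 1

/-- Relation symbols of the signature `{f, I, T}`: a unary relation `I` and a
ternary relation `T`. -/
inductive FASRel : ℕ → Type
  | i : FASRel 1
  | t : FASRel 3

/-- The first-order signature with one unary function symbol `f`, one unary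
relation symbol `I`, and one ternary relation symbol `T`. -/
def fasLang : Language := ⟨FASFunc, FASRel⟩

/-- Labelled FAS-type data on the universe `Fin n`. -/
abbrev FASData (n : ℕ) :=
  (Fin n → Fin n) × Finset (Fin n) × Finset (Fin n × Fin n × Fin n)

/-- The conditions (P) and (I) defining FAS structures. -/
def IsFAS {n : ℕ} (M : FASData n) : Prop :=
  (∀ a b c : Fin n, (a, b, c) ∈ M.2.2 → (M.1 a, c, b) ∈ M.2.2 ∧ (c, M.1 b, a) ∈ M.2.2) ∧
  (∀ a b : Fin n, a = b ↔ ∃ i ∈ M.2.1, (a, i, b) ∈ M.2.2)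

/-- A structure is symmetric iff `f` is the identity. -/
def FASSymmetric {n : ℕ} (M : FASData n) : Prop := ∀ x, M.1 x = x

/-- A structure is integral iff `|I| = 1`. -/
def FASIntegral {n : ℕ} (M : FASData n) : Prop := M.2.1.card = 1

/-- The `fasLang`-structure on `Fin n` determined by `M`. -/
def toStructure {n : ℕ} (M : FASData n) : fasLang.Structure (Fin n) where
  funMap {l} F v :=
    match F with
    | .f => M.1 (v 0)
  RelMap {l} r v :=
    match r with
    | .i => v 0 ∈ M.2.1
    | .t => (v 0, v 1, v 2) ∈ M.2.2

/-- `M` satisfies the first-order sentence `σ`. -/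
def SatSentence {n : ℕ} (M : FASData n) (σ : fasLang.Sentence) : Prop :=
  @FirstOrder.Language.Sentence.Realize fasLang (Fin n) (toStructure M) σ

/-- Finite symmetric integral FAS structures. -/
def IsFSIAS {n : ℕ} (M : FASData n) : Prop := IsFAS M ∧ FASSymmetric M ∧ FASIntegral M

/-- Tables recording equality, `I` and `T` on a tuple of length `m`. -/
abbrev Diagram (m : ℕ) : Type :=
  (Fin m → Fin m → Prop) × (Fin m → Prop) × (Fin m → Fin m → Fin m → Prop)

/-- Reindexing of a diagram. -/
def Diagram.comap {k m : ℕ} (t : Diagram m) (g : Fin k → Fin m) : Diagram k :=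
  (fun i j => t.1 (g i) (g j), fun i => t.2.1 (g i), fun i j l => t.2.2 (g i) (g j) (g l))

/-- The atomic diagram of a tuple in a structure. -/
def diagram {n m : ℕ} (M : FASData n) (v : Fin m → Fin n) : Diagram m :=
  (fun i j => v i = v j, fun i => v i ∈ M.2.1, fun i j l => (v i, v j, v l) ∈ M.2.2)

lemma diagram_comp {n m k : ℕ} (M : FASData n) (v : Fin m → Fin n) (g : Fin k → Fin m) :
    diagram M (v ∘ g) = (diagram M v).comap g := rfl

lemma diagram_eq_iff {n n' m : ℕ} {M : FASData n} {N : FASData n'} {v : Fin m → Fin n}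
    {w : Fin m → Fin n'} :
    diagram M v = diagram N w ↔ (∀ i j, v i = v j ↔ w i = w j) ∧
      (∀ i, v i ∈ M.2.1 ↔ w i ∈ N.2.1) ∧
      (∀ i j l, (v i, v j, v l) ∈ M.2.2 ↔ (w i, w j, w l) ∈ N.2.2) := by
  simp only [diagram, Prod.mk.injEq, funext_iff, eq_iff_iff]

lemma diagram_castSucc_snoc {n m : ℕ} (M : FASData n) (v : Fin m → Fin n) (a : Fin n) :
    (diagram M (Fin.snoc v a : Fin (m + 1) → Fin n)).comap Fin.castSucc = diagram M v := by
  rw [← diagram_comp]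
  congr 1
  funext i
  simp

namespace IsFSIAS

variable {n : ℕ} {M : FASData n}

lemma swap_right (h : IsFSIAS M) {a b c : Fin n} (ht : (a, b, c) ∈ M.2.2) :
    (a, c, b) ∈ M.2.2 := by
  simpa [h.2.1 a] using (h.1.1 a b c ht).1

lemma swap_outer (h : IsFSIAS M) {a b c : Fin n} (ht : (a, b, c) ∈ M.2.2) :
    (c, b, a) ∈ M.2.2 := by
  simpa [h.2.1 b] using (h.1.1 a b c ht).2

lemma exists_eq_singleton (h : IsFSIAS M) : ∃ e, M.2.1 = {e} := Finset.card_eq_one.1 h.2.2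

lemma eq_of_mem (h : IsFSIAS M) {a b : Fin n} (ha : a ∈ M.2.1) (hb : b ∈ M.2.1) : a = b := by
  obtain ⟨e, he⟩ := h.exists_eq_singleton
  simp_all

lemma mem_middle (h : IsFSIAS M) {e : Fin n} (he : e ∈ M.2.1) (x y : Fin n) :
    (x, e, y) ∈ M.2.2 ↔ x = y := by
  rw [h.1.2]
  exact ⟨fun ht => ⟨e, he, ht⟩, fun ⟨i, hi, ht⟩ => h.eq_of_mem he hi ▸ ht⟩

lemma mem_right (h : IsFSIAS M) {e : Fin n} (he : e ∈ M.2.1) (x y : Fin n) :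
    (x, y, e) ∈ M.2.2 ↔ x = y := by
  rw [← h.mem_middle he]
  exact ⟨h.swap_right, h.swap_right⟩

lemma mem_left (h : IsFSIAS M) {e : Fin n} (he : e ∈ M.2.1) (x y : Fin n) :
    (e, x, y) ∈ M.2.2 ↔ x = y := by
  rw [eq_comm, ← h.mem_right he]
  exact ⟨h.swap_outer, h.swap_outer⟩

end IsFSIAS

lemma exists_isFSIAS {n : ℕ} (hn : 0 < n) : ∃ M : FASData n, IsFSIAS M := by
  have : NeZero n := ⟨hn.ne'⟩
  refine ⟨(id, {0}, Finset.univ.filter fun p => (p.1 = 0 ∧ p.2.1 = p.2.2) ∨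
    (p.2.1 = 0 ∧ p.1 = p.2.2) ∨ (p.2.2 = 0 ∧ p.1 = p.2.1)), ⟨?_, ?_⟩, fun _ => rfl, by
      simp [FASIntegral]⟩
  · simp only [Finset.mem_filter, Finset.mem_univ, true_and, id]
    grind
  · simp only [Finset.mem_filter, Finset.mem_univ, true_and, Finset.mem_singleton]
    grind

/-- The one-point extension property for tuples of length `m`: any one-point extension, inside
some symmetric integral structure, of a copy of a tuple can be copied in `N`. -/
def HasExtension (m : ℕ) {n : ℕ} (N : FASData n) : Prop :=
  ∀ (w : Fin m → Fin n) (n' : ℕ) (M : FASData n') (v : Fin m → Fin n') (a : Fin n'),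
    IsFSIAS M → diagram M v = diagram N w →
    ∃ b, diagram M (Fin.snoc v a : Fin (m + 1) → Fin n') =
      diagram N (Fin.snoc w b : Fin (m + 1) → Fin n)

/-! ### Elementary equivalence of structures with extension properties -/

lemma exists_realize_term_eq {m : ℕ} (t : fasLang.Term (Empty ⊕ Fin m)) :
    ∃ i : Fin m, ∀ (n : ℕ) (M : FASData n), IsFSIAS M → ∀ (x : Empty → Fin n) (v : Fin m → Fin n),
      @Language.Term.realize fasLang (Fin n) (toStructure M) _ (Sum.elim x v) t = v i := by
  induction t with
  | var s =>
    rcases s with s | i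
    · exact s.elim
    · exact ⟨i, fun _ _ _ _ _ => rfl⟩
  | func F ts ih =>
    cases F
    obtain ⟨i, hi⟩ := ih 0
    refine ⟨i, fun n M hM x v => ?_⟩
    rw [← hi n M hM x v]
    exact hM.2.1 _

lemma exists_realize_iff {m : ℕ} (φ : fasLang.BoundedFormula Empty m) :
    ∃ k : ℕ, ∀ (n n' : ℕ) (M : FASData n) (N : FASData n'), IsFSIAS M → IsFSIAS N →
      (∀ j < k, HasExtension j M) → (∀ j < k, HasExtension j N) →
      ∀ (x : Empty → Fin n) (y : Empty → Fin n') (v : Fin m → Fin n) (w : Fin m → Fin n'),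
      diagram M v = diagram N w →
      (@Language.BoundedFormula.Realize fasLang (Fin n) (toStructure M) _ _ φ x v ↔
        @Language.BoundedFormula.Realize fasLang (Fin n') (toStructure N) _ _ φ y w) := by
  induction φ with
  | falsum => exact ⟨0, fun _ _ _ _ _ _ _ _ _ _ _ _ _ => Iff.rfl⟩
  | equal t₁ t₂ =>
    obtain ⟨i, hi⟩ := exists_realize_term_eq t₁
    obtain ⟨j, hj⟩ := exists_realize_term_eq t₂
    refine ⟨0, fun n n' M N hM hN _ _ x y v w h => ?_⟩
    simp only [Language.BoundedFormula.Realize]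
    rw [hi n M hM, hj n M hM, hi n' N hN, hj n' N hN]
    exact (diagram_eq_iff.1 h).1 i j
  | rel R ts =>
    choose g hg using fun i => exists_realize_term_eq (ts i)
    refine ⟨0, fun n n' M N hM hN _ _ x y v w h => ?_⟩
    simp only [Language.BoundedFormula.Realize]
    simp only [hg _ n M hM, hg _ n' N hN]
    cases R with
    | i => exact (diagram_eq_iff.1 h).2.1 (g 0)
    | t => exact (diagram_eq_iff.1 h).2.2 (g 0) (g 1) (g 2)
  | imp φ ψ ihφ ihψ =>
    obtain ⟨k, hk⟩ := ihφ
    obtain ⟨l, hl⟩ := ihψ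
    refine ⟨max k l, fun n n' M N hM hN eM eN x y v w h => ?_⟩
    exact imp_congr
      (hk n n' M N hM hN (fun j hj => eM j (by omega)) (fun j hj => eN j (by omega)) x y v w h)
      (hl n n' M N hM hN (fun j hj => eM j (by omega)) (fun j hj => eN j (by omega)) x y v w h)
  | @all m φ ih =>
    obtain ⟨k, hk⟩ := ih
    refine ⟨max k (m + 1), fun n n' M N hM hN eM eN x y v w h => ?_⟩
    have key := hk n n' M N hM hN (fun j hj => eM j (by omega)) (fun j hj => eN j (by omega)) x y
    constructor
    · intro H b
      obtain ⟨a, ha⟩ := eM m (by omega) v n' N w b hN h.symm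
      exact (key _ _ ha.symm).1 (H a)
    · intro H a
      obtain ⟨b, hb⟩ := eN m (by omega) w n M v a hM h
      exact (key _ _ hb).2 (H b)

/-! ### Structures without extensions are rare -/

/-- `t` is the diagram of a tuple whose last entry is neither the identity element nor equal to
an earlier entry. -/
def IsFreshType {m : ℕ} (t : Diagram (m + 1)) : Prop :=
  ∃ (n : ℕ) (M : FASData n) (u : Fin (m + 1) → Fin n), IsFSIAS M ∧ diagram M u = t ∧
    (∀ i : Fin m, u i.castSucc ≠ u (Fin.last m)) ∧ u (Fin.last m) ∉ M.2.1

/-- The triples through `b` with all entries in the tuple `w` or equal to `b`. -/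
def IsSlot {n m : ℕ} (w : Fin m → Fin n) (b x y z : Fin n) : Prop :=
  (x = b ∨ y = b ∨ z = b) ∧ ∃ i j l, (Fin.snoc w b : Fin (m + 1) → Fin n) i = x ∧
    (Fin.snoc w b : Fin (m + 1) → Fin n) j = y ∧ (Fin.snoc w b : Fin (m + 1) → Fin n) l = z

/-- The triples on the tuple `w` extended by `b` prescribed by the diagram `t`. -/
def Prescribed {n m : ℕ} (t : Diagram (m + 1)) (w : Fin m → Fin n) (b x y z : Fin n) : Prop :=
  ∃ i j l, (Fin.snoc w b : Fin (m + 1) → Fin n) i = x ∧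
    (Fin.snoc w b : Fin (m + 1) → Fin n) j = y ∧
    (Fin.snoc w b : Fin (m + 1) → Fin n) l = z ∧ t.2.2 i j l

open Classical in
/-- Change the triples of `N` so that `w` extended by `b` acquires the diagram `t`. -/
noncomputable def overwrite {n m : ℕ} (t : Diagram (m + 1)) (w : Fin m → Fin n) (b : Fin n)
    (N : FASData n) : FASData n :=
  (N.1, N.2.1, Finset.univ.filter fun p =>
    if IsSlot w b p.1 p.2.1 p.2.2 then Prescribed t w b p.1 p.2.1 p.2.2 else p ∈ N.2.2)

open Classical in
lemma mem_overwrite {n m : ℕ} (t : Diagram (m + 1)) (w : Fin m → Fin n) (b : Fin n)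
    (N : FASData n) (x y z : Fin n) : (x, y, z) ∈ (overwrite t w b N).2.2 ↔
      if IsSlot w b x y z then Prescribed t w b x y z else (x, y, z) ∈ N.2.2 := by
  simp [overwrite]

/-- `b` is neither in the tuple `w` nor in `I`. -/
def IsFresh {n m : ℕ} (N : FASData n) (w : Fin m → Fin n) (b : Fin n) : Prop :=
  b ∉ N.2.1 ∧ ∀ i, w i ≠ b

lemma IsSlot.swap_right {n m : ℕ} {w : Fin m → Fin n} {b x y z : Fin n} (h : IsSlot w b x y z) :
    IsSlot w b x z y := by
  obtain ⟨h, i, j, l, hi, hj, hl⟩ := h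
  exact ⟨by tauto, i, l, j, hi, hl, hj⟩

lemma IsSlot.swap_outer {n m : ℕ} {w : Fin m → Fin n} {b x y z : Fin n} (h : IsSlot w b x y z) :
    IsSlot w b z y x := by
  obtain ⟨h, i, j, l, hi, hj, hl⟩ := h
  exact ⟨by tauto, l, j, i, hl, hj, hi⟩

section Overwrite

variable {n n' m : ℕ} {N : FASData n} {M : FASData n'} {u : Fin (m + 1) → Fin n'}
  {w : Fin m → Fin n} {b : Fin n}

lemma snoc_agree (hu : ∀ i : Fin m, u i.castSucc ≠ u (Fin.last m)) (hu' : u (Fin.last m) ∉ M.2.1)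
    (hb : IsFresh N w b) (hw : diagram N w = (diagram M u).comap Fin.castSucc) :
    (∀ i j, (Fin.snoc w b : Fin (m + 1) → Fin n) i = (Fin.snoc w b : Fin (m + 1) → Fin n) j ↔
      u i = u j) ∧
    (∀ i, (Fin.snoc w b : Fin (m + 1) → Fin n) i ∈ N.2.1 ↔ u i ∈ M.2.1) := by
  rw [← diagram_comp, diagram_eq_iff] at hw
  obtain ⟨h1, h2, -⟩ := hw
  refine ⟨fun i j => ?_, fun i => ?_⟩
  · induction i using Fin.lastCases with
    | last =>
      induction j using Fin.lastCases with
      | last => simp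
      | cast j => simpa [(hu j).symm] using (hb.2 j).symm
    | cast i =>
      induction j using Fin.lastCases with
      | last => simpa [hu i] using hb.2 i
      | cast j => simpa using h1 i j
  · induction i using Fin.lastCases with
    | last => simpa [hu'] using hb.1
    | cast i => simpa using h2 i

lemma prescribed_snoc_iff
    (h : ∀ i j, (Fin.snoc w b : Fin (m + 1) → Fin n) i =
      (Fin.snoc w b : Fin (m + 1) → Fin n) j ↔ u i = u j) (i j l : Fin (m + 1)) :
    Prescribed (diagram M u) w b ((Fin.snoc w b : Fin (m + 1) → Fin n) i)
      ((Fin.snoc w b : Fin (m + 1) → Fin n) j) ((Fin.snoc w b : Fin (m + 1) → Fin n) l) ↔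
    (u i, u j, u l) ∈ M.2.2 := by
  constructor
  · rintro ⟨i', j', l', hi, hj, hl, ht⟩
    rw [h] at hi hj hl
    rw [← hi, ← hj, ← hl]
    exact ht
  · exact fun ht => ⟨i, j, l, rfl, rfl, rfl, ht⟩

lemma overwrite_isFSIAS (hM : IsFSIAS M) (hN : IsFSIAS N)
    (hu : ∀ i : Fin m, u i.castSucc ≠ u (Fin.last m)) (hu' : u (Fin.last m) ∉ M.2.1)
    (hb : IsFresh N w b) (hw : diagram N w = (diagram M u).comap Fin.castSucc) :
    IsFSIAS (overwrite (diagram M u) w b N) := by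
  obtain ⟨h1, h2⟩ := snoc_agree hu hu' hb hw
  refine ⟨⟨fun x y z h => ?_, fun x y => ?_⟩, hN.2.1, hN.2.2⟩
  · have hf : ∀ x, (overwrite (diagram M u) w b N).1 x = x := hN.2.1
    rw [hf, hf]
    rw [mem_overwrite] at h ⊢
    rw [mem_overwrite]
    by_cases hs : IsSlot w b x y z
    · rw [if_pos hs] at h
      rw [if_pos hs.swap_right, if_pos hs.swap_outer]
      obtain ⟨i, j, l, hi, hj, hl, ht⟩ := h
      exact ⟨⟨i, l, j, hi, hl, hj, hM.swap_right ht⟩, ⟨l, j, i, hl, hj, hi, hM.swap_outer ht⟩⟩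
    · rw [if_neg hs] at h
      rw [if_neg fun h' => hs h'.swap_right, if_neg fun h' => hs h'.swap_outer]
      exact ⟨hN.swap_right h, hN.swap_outer h⟩
  · obtain ⟨e, he⟩ := hN.exists_eq_singleton
    have heN : e ∈ N.2.1 := by simp [he]
    have hI : (overwrite (diagram M u) w b N).2.1 = {e} := he
    simp only [hI, Finset.mem_singleton, exists_eq_left, mem_overwrite]
    by_cases hs : IsSlot w b x e y
    · rw [if_pos hs]
      obtain ⟨-, i, j, l, rfl, hj, rfl⟩ := hs
      rw [← hj, prescribed_snoc_iff h1, hM.mem_middle ((h2 j).1 (hj ▸ heN)), h1]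
    · rw [if_neg hs, hN.mem_middle heN]

lemma diagram_overwrite (hu : ∀ i : Fin m, u i.castSucc ≠ u (Fin.last m))
    (hu' : u (Fin.last m) ∉ M.2.1) (hb : IsFresh N w b)
    (hw : diagram N w = (diagram M u).comap Fin.castSucc) :
    diagram (overwrite (diagram M u) w b N) (Fin.snoc w b : Fin (m + 1) → Fin n) =
      diagram M u := by
  obtain ⟨h1, h2⟩ := snoc_agree hu hu' hb hw
  refine diagram_eq_iff.2 ⟨h1, h2, fun i j l => ?_⟩
  rw [mem_overwrite]
  split_ifs with hs
  · exact prescribed_snoc_iff h1 i j l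
  · have hne : ∀ i, (Fin.snoc w b : Fin (m + 1) → Fin n) i ≠ b → ∃ i' : Fin m, i = i'.castSucc := by
      intro i hi
      induction i using Fin.lastCases with
      | last => simp at hi
      | cast i => exact ⟨i, rfl⟩
    have hs' : ¬ (_ ∨ _ ∨ _) := fun h => hs ⟨h, i, j, l, rfl, rfl, rfl⟩
    push Not at hs'
    obtain ⟨i, rfl⟩ := hne i hs'.1
    obtain ⟨j, rfl⟩ := hne j hs'.2.1
    obtain ⟨l, rfl⟩ := hne l hs'.2.2
    rw [← diagram_comp, diagram_eq_iff] at hw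
    simpa using hw.2.2 i j l

lemma diagram_overwrite_of_ne {k : ℕ} (t : Diagram (m + 1)) {v : Fin k → Fin n}
    (hv : ∀ i, v i ≠ b) : diagram (overwrite t w b N) v = diagram N v := by
  refine diagram_eq_iff.2 ⟨fun _ _ => Iff.rfl, fun _ => Iff.rfl, fun i j l => ?_⟩
  rw [mem_overwrite, if_neg]
  rintro ⟨h, -⟩
  simp [hv] at h

lemma eq_of_overwrite_eq {t : Diagram (m + 1)} {N₁ N₂ : FASData n} (h₁ : IsFSIAS N₁)
    (h₂ : IsFSIAS N₂) (h : overwrite t w b N₁ = overwrite t w b N₂)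
    (hd : diagram N₁ (Fin.snoc w b : Fin (m + 1) → Fin n) =
      diagram N₂ (Fin.snoc w b : Fin (m + 1) → Fin n)) : N₁ = N₂ := by
  have hI : (overwrite t w b N₁).2.1 = (overwrite t w b N₂).2.1 := by rw [h]
  refine Prod.ext (funext fun x => (h₁.2.1 x).trans (h₂.2.1 x).symm) (Prod.ext hI ?_)
  ext ⟨x, y, z⟩
  by_cases hs : IsSlot w b x y z
  · obtain ⟨-, i, j, l, rfl, rfl, rfl⟩ := hs
    exact (diagram_eq_iff.1 hd).2.2 i j l
  · have := mem_overwrite t w b N₁ x y z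
    rw [h, mem_overwrite, if_neg hs, if_neg hs] at this
    exact this.symm

end Overwrite

open Classical in
/-- The structures with identity element `e` in which the tuple `w` has the diagram obtained by
restricting `t`, and no point of `B` extends it to `t`. -/
noncomputable def omitting {n m : ℕ} (t : Diagram (m + 1)) (w : Fin m → Fin n) (e : Fin n)
    (B : Finset (Fin n)) : Finset (FASData n) :=
  Finset.univ.filter fun N => IsFSIAS N ∧ N.2.1 = {e} ∧ diagram N w = t.comap Fin.castSucc ∧
    ∀ b ∈ B, diagram N (Fin.snoc w b : Fin (m + 1) → Fin n) ≠ t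

lemma mem_omitting {n m : ℕ} {t : Diagram (m + 1)} {w : Fin m → Fin n} {e : Fin n}
    {B : Finset (Fin n)} {N : FASData n} : N ∈ omitting t w e B ↔ IsFSIAS N ∧ N.2.1 = {e} ∧
      diagram N w = t.comap Fin.castSucc ∧
      ∀ b ∈ B, diagram N (Fin.snoc w b : Fin (m + 1) → Fin n) ≠ t := by
  simp [omitting]

open Classical in
lemma card_omitting_le {n m : ℕ} {t : Diagram (m + 1)} (ht : IsFreshType t) (w : Fin m → Fin n)
    {e b : Fin n} (B : Finset (Fin n)) (hbB : b ∉ B) (hbe : b ≠ e) (hbw : ∀ i, w i ≠ b) :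
    (omitting t w e B).card ≤ Nat.card (Diagram (m + 1)) *
      (omitting t w e B \ omitting t w e (insert b B)).card := by
  have := Fintype.ofFinite (Diagram (m + 1))
  obtain ⟨n', M, u, hM, rfl, hu, hu'⟩ := ht
  rw [Nat.card_eq_fintype_card, ← Finset.card_univ, ← Finset.card_product]
  refine Finset.card_le_card_of_injOn (fun N =>
    (diagram N (Fin.snoc w b : Fin (m + 1) → Fin n), overwrite (diagram M u) w b N)) ?_ ?_
  · intro N hN
    obtain ⟨hN, he, hw, hB⟩ := mem_omitting.1 hN
    have hb : IsFresh N w b := ⟨by simpa [he] using hbe, hbw⟩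
    simp only [Finset.coe_product, Set.mem_prod, Finset.coe_univ, Set.mem_univ, true_and,
      Finset.mem_coe, Finset.mem_sdiff, mem_omitting]
    refine ⟨⟨overwrite_isFSIAS hM hN hu hu' hb hw, he, ?_, fun c hc => ?_⟩, fun h => ?_⟩
    · rw [diagram_overwrite_of_ne _ hbw, hw]
    · rw [diagram_overwrite_of_ne]
      · exact hB c hc
      · intro i
        induction i using Fin.lastCases with
        | last =>
          rw [Fin.snoc_last]
          rintro rfl
          exact hbB hc
        | cast i => simpa using hbw i
    · exact h.2.2.2 b (Finset.mem_insert_self _ _) (diagram_overwrite hu hu' hb hw)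
  · intro N₁ h₁ N₂ h₂ h
    simp only [Prod.mk.injEq] at h
    exact eq_of_overwrite_eq (mem_omitting.1 h₁).1 (mem_omitting.1 h₂).1 h.2 h.1

lemma omitting_anti {n m : ℕ} (t : Diagram (m + 1)) (w : Fin m → Fin n) (e : Fin n)
    {B C : Finset (Fin n)} (h : B ⊆ C) : omitting t w e C ⊆ omitting t w e B := by
  intro N hN
  rw [mem_omitting] at hN ⊢
  exact ⟨hN.1, hN.2.1, hN.2.2.1, fun b hb => hN.2.2.2 b (h hb)⟩

open Classical in
/-- The symmetric integral FAS structures on `Fin n`. -/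
noncomputable def fsias (n : ℕ) : Finset (FASData n) := Finset.univ.filter IsFSIAS

/-- The factor by which one more point reduces the number of structures omitting a diagram. -/
noncomputable def omitRatio (m : ℕ) : ℝ := 1 - (Nat.card (Diagram (m + 1)) : ℝ)⁻¹

lemma omitRatio_nonneg (m : ℕ) : 0 ≤ omitRatio m :=
  sub_nonneg.2 (Nat.cast_inv_le_one _)

lemma omitRatio_lt_one (m : ℕ) : omitRatio m < 1 := by
  have : 0 < Nat.card (Diagram (m + 1)) := Nat.card_pos
  exact sub_lt_self _ (by positivity)

lemma card_omitting_le_pow {n m : ℕ} {t : Diagram (m + 1)} (ht : IsFreshType t)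
    (w : Fin m → Fin n) (e : Fin n) (B : Finset (Fin n)) (hB : ∀ b ∈ B, b ≠ e ∧ ∀ i, w i ≠ b) :
    ((omitting t w e B).card : ℝ) ≤ omitRatio m ^ B.card * (fsias n).card := by
  classical
  induction B using Finset.induction_on with
  | empty =>
    simp only [Finset.card_empty, pow_zero, one_mul, Nat.cast_le]
    refine Finset.card_le_card fun N hN => ?_
    simpa [fsias] using (mem_omitting.1 hN).1
  | insert b B hbB ih =>
    have ih := ih fun c hc => hB c (Finset.mem_insert_of_mem hc)
    obtain ⟨hbe, hbw⟩ := hB b (Finset.mem_insert_self _ _)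
    have h := card_omitting_le ht w B hbB hbe hbw
    have hsub := omitting_anti t w e (Finset.subset_insert b B)
    have hcard := Finset.card_sdiff_add_card_eq_card hsub
    have hK : (0 : ℝ) < Nat.card (Diagram (m + 1)) := by exact_mod_cast Nat.card_pos
    have h' : ((omitting t w e B).card : ℝ) ≤ Nat.card (Diagram (m + 1)) *
        ((omitting t w e B).card - (omitting t w e (insert b B)).card) := by
      rw [← hcard]
      push_cast
      rw [add_sub_cancel_right]
      exact_mod_cast hcard.symm ▸ h
    have hstep : ((omitting t w e (insert b B)).card : ℝ) ≤
        omitRatio m * (omitting t w e B).card := by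
      rw [← inv_mul_le_iff₀ hK] at h'
      rw [omitRatio, sub_mul]
      linarith
    rw [Finset.card_insert_of_notMem hbB, pow_succ', mul_assoc]
    exact hstep.trans (mul_le_mul_of_nonneg_left ih (omitRatio_nonneg m))

lemma diagram_snoc_identity {n n' m : ℕ} {M : FASData n} {N : FASData n'} (hM : IsFSIAS M)
    (hN : IsFSIAS N) {v : Fin m → Fin n} {w : Fin m → Fin n'} (h : diagram M v = diagram N w)
    {a : Fin n} {e : Fin n'} (ha : a ∈ M.2.1) (he : e ∈ N.2.1) :
    diagram M (Fin.snoc v a : Fin (m + 1) → Fin n) =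
      diagram N (Fin.snoc w e : Fin (m + 1) → Fin n') := by
  obtain ⟨h1, h2, h3⟩ := diagram_eq_iff.1 h
  have hMa : ∀ x, x = a ↔ x ∈ M.2.1 := fun x => ⟨fun hx => hx ▸ ha, fun hx => hM.eq_of_mem hx ha⟩
  have hNe : ∀ x, x = e ↔ x ∈ N.2.1 := fun x => ⟨fun hx => hx ▸ he, fun hx => hN.eq_of_mem hx he⟩
  have h4 : ∀ i, v i = a ↔ w i = e := fun i => by rw [hMa, hNe, h2]
  have h5 : ∀ i, a = v i ↔ e = w i := fun i => by rw [eq_comm, h4, eq_comm]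
  refine diagram_eq_iff.2 ⟨fun i j => ?_, fun i => ?_, fun i j l => ?_⟩
  · induction i using Fin.lastCases <;> induction j using Fin.lastCases <;> simp [*]
  · induction i using Fin.lastCases <;> simp [*]
  · induction i using Fin.lastCases <;> induction j using Fin.lastCases <;>
      induction l using Fin.lastCases <;>
      simp [h1, h3, h4, h5, hM.mem_left ha, hM.mem_middle ha, hM.mem_right ha, hN.mem_left he,
        hN.mem_middle he, hN.mem_right he]

lemma exists_mem_omitting {n m : ℕ} {N : FASData n} (hN : IsFSIAS N) (h : ¬ HasExtension m N) :
    ∃ (t : Diagram (m + 1)) (w : Fin m → Fin n) (e : Fin n), IsFreshType t ∧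
      ∀ B, N ∈ omitting t w e B := by
  simp only [HasExtension, not_forall, not_exists] at h
  obtain ⟨w, n', M, v, a, hM, hvw, hno⟩ := h
  obtain ⟨e, he⟩ := hN.exists_eq_singleton
  refine ⟨diagram M (Fin.snoc v a : Fin (m + 1) → Fin n'), w, e,
    ⟨n', M, _, hM, rfl, fun i => ?_, fun ha => ?_⟩, fun B => mem_omitting.2 ⟨hN, he, ?_, ?_⟩⟩
  · simp only [Fin.snoc_castSucc, Fin.snoc_last]
    rintro rfl
    apply hno (w i)
    have hs : ∀ {k : ℕ} (x : Fin m → Fin k),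
        (Fin.snoc x (x i) : Fin (m + 1) → Fin k) = x ∘ (Fin.snoc id i : Fin (m + 1) → Fin m) := by
      intro k x
      funext j
      induction j using Fin.lastCases <;> simp
    rw [hs, hs, diagram_comp, diagram_comp, hvw]
  · rw [Fin.snoc_last] at ha
    exact hno e (diagram_snoc_identity hM hN hvw ha (by simp [he]))
  · rw [diagram_castSucc_snoc, hvw]
  · exact fun b _ hb => hno b hb.symm

open Classical in
lemma card_not_hasExtension_le (m n : ℕ) :
    (((fsias n).filter fun N => ¬ HasExtension m N).card : ℝ) ≤
      Nat.card (Diagram (m + 1)) * n ^ (m + 1) * omitRatio m ^ (n - (m + 1)) *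
        (fsias n).card := by
  have := Fintype.ofFinite (Diagram (m + 1))
  let B : (Fin m → Fin n) → Fin n → Finset (Fin n) :=
    fun w e => (insert e (Finset.univ.image w))ᶜ
  let I : Finset (Diagram (m + 1) × (Fin m → Fin n) × Fin n) :=
    Finset.univ.filter fun x => IsFreshType x.1
  have hsub : ((fsias n).filter fun N => ¬ HasExtension m N) ⊆
      I.biUnion fun x => omitting x.1 x.2.1 x.2.2 (B x.2.1 x.2.2) := by
    intro N hN
    simp only [fsias, Finset.mem_filter, Finset.mem_univ, true_and] at hN
    obtain ⟨t, w, e, ht, h⟩ := exists_mem_omitting hN.1 hN.2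
    exact Finset.mem_biUnion.2 ⟨(t, w, e), by simpa [I] using ht, h _⟩
  have hterm : ∀ x ∈ I, ((omitting x.1 x.2.1 x.2.2 (B x.2.1 x.2.2)).card : ℝ) ≤
      omitRatio m ^ (n - (m + 1)) * (fsias n).card := by
    rintro ⟨t, w, e⟩ hx
    have ht : IsFreshType t := by simpa [I] using hx
    refine (card_omitting_le_pow ht w e (B w e) fun b hb => ?_).trans ?_
    · simpa [B] using hb
    · refine mul_le_mul_of_nonneg_right (pow_le_pow_of_le_one (omitRatio_nonneg m)
        (omitRatio_lt_one m).le ?_) (Nat.cast_nonneg _)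
      have h1 : (insert e (Finset.univ.image w)).card ≤ m + 1 :=
        (Finset.card_insert_le _ _).trans
          (Nat.succ_le_succ (Finset.card_image_le.trans (by simp)))
      simp only [B, Finset.card_compl, Fintype.card_fin]
      omega
  have hI : (I.card : ℝ) ≤ Nat.card (Diagram (m + 1)) * n ^ (m + 1) := by
    have h1 : I.card ≤ Nat.card (Diagram (m + 1)) * n ^ (m + 1) := by
      refine (Finset.card_le_univ I).trans (le_of_eq ?_)
      rw [Fintype.card_prod, Fintype.card_prod, Nat.card_eq_fintype_card]
      simp [pow_succ]
    exact_mod_cast h1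
  calc (((fsias n).filter fun N => ¬ HasExtension m N).card : ℝ)
      ≤ ∑ x ∈ I, ((omitting x.1 x.2.1 x.2.2 (B x.2.1 x.2.2)).card : ℝ) := by
        exact_mod_cast (Finset.card_le_card hsub).trans Finset.card_biUnion_le
    _ ≤ I.card * (omitRatio m ^ (n - (m + 1)) * (fsias n).card) := by
        simpa using Finset.sum_le_card_nsmul _ _ _ hterm
    _ ≤ Nat.card (Diagram (m + 1)) * n ^ (m + 1) *
          (omitRatio m ^ (n - (m + 1)) * (fsias n).card) :=
        mul_le_mul_of_nonneg_right hI
          (mul_nonneg (pow_nonneg (omitRatio_nonneg m) _) (Nat.cast_nonneg _))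
    _ = _ := by ring

lemma tendsto_pow_mul_pow_sub (k : ℕ) {r : ℝ} (h0 : 0 ≤ r) (h1 : r < 1) :
    Tendsto (fun n : ℕ => (n : ℝ) ^ k * r ^ (n - k)) atTop (𝓝 0) := by
  rw [← tendsto_add_atTop_iff_nat k]
  have hdom : Tendsto (fun n : ℕ => (k + 1 : ℝ) ^ k * (((n : ℝ) ^ k * r ^ n) + r ^ n))
      atTop (𝓝 0) := by
    simpa using ((tendsto_pow_const_mul_const_pow_of_lt_one k h0 h1).add
      (tendsto_pow_atTop_nhds_zero_of_lt_one h0 h1)).const_mul ((k + 1 : ℝ) ^ k)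
  refine squeeze_zero (fun n => by positivity) (fun n => ?_) hdom
  rw [Nat.add_sub_cancel]
  have hr : 0 ≤ r ^ n := pow_nonneg h0 n
  have hle : ((n + k : ℕ) : ℝ) ^ k ≤ (k + 1 : ℝ) ^ k * ((n : ℝ) ^ k + 1) := by
    rcases Nat.eq_zero_or_pos n with rfl | hn
    · have h2 : ((0 + k : ℕ) : ℝ) ^ k ≤ (k + 1 : ℝ) ^ k :=
        pow_le_pow_left₀ (by positivity) (by push_cast; linarith) k
      exact h2.trans (le_mul_of_one_le_right (by positivity) (by simp))
    · have hn' : (1 : ℝ) ≤ n := by exact_mod_cast hn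
      have h2 : ((n + k : ℕ) : ℝ) ^ k ≤ ((k + 1 : ℝ) * n) ^ k := by
        refine pow_le_pow_left₀ (by positivity) ?_ k
        push_cast
        nlinarith [mul_nonneg (Nat.cast_nonneg k : (0 : ℝ) ≤ k) (sub_nonneg.2 hn')]
      rw [mul_pow] at h2
      refine h2.trans (mul_le_mul_of_nonneg_left (by linarith) (by positivity))
  calc _ ≤ (k + 1 : ℝ) ^ k * ((n : ℝ) ^ k + 1) * r ^ n := mul_le_mul_of_nonneg_right hle hr
    _ = _ := by ring

open Classical in
lemma tendsto_not_hasExtension (m : ℕ) :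
    Tendsto (fun n : ℕ => (((fsias n).filter fun N => ¬ HasExtension m N).card : ℝ) /
      (fsias n).card) atTop (𝓝 0) := by
  have hlim := (tendsto_pow_mul_pow_sub (m + 1) (omitRatio_nonneg m)
    (omitRatio_lt_one m)).const_mul (Nat.card (Diagram (m + 1)) : ℝ)
  rw [mul_zero] at hlim
  refine squeeze_zero (fun n => by positivity) (fun n => ?_) hlim
  refine div_le_of_le_mul₀ (Nat.cast_nonneg _) ?_ ?_
  · exact mul_nonneg (Nat.cast_nonneg _)
      (mul_nonneg (by positivity) (pow_nonneg (omitRatio_nonneg m) _))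
  · rw [← mul_assoc]
    exact card_not_hasExtension_le m n

open Classical in
lemma tendsto_not_forall_hasExtension (k : ℕ) :
    Tendsto (fun n : ℕ => (((fsias n).filter fun N => ¬ ∀ j < k, HasExtension j N).card : ℝ) /
      (fsias n).card) atTop (𝓝 0) := by
  have hlim := tendsto_finsetSum (Finset.range k) fun j _ => tendsto_not_hasExtension j
  rw [Finset.sum_const_zero] at hlim
  refine squeeze_zero (fun n => by positivity) (fun n => ?_) hlim
  rw [← Finset.sum_div]
  refine div_le_div_of_nonneg_right ?_ (Nat.cast_nonneg _)
  have hsub : ((fsias n).filter fun N => ¬ ∀ j < k, HasExtension j N) ⊆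
      (Finset.range k).biUnion fun j => (fsias n).filter fun N => ¬ HasExtension j N := by
    intro N
    simp only [Finset.mem_filter, Finset.mem_biUnion, Finset.mem_range]
    push Not
    rintro ⟨h, j, hj, hj'⟩
    exact ⟨j, hj, h, hj'⟩
  exact_mod_cast (Finset.card_le_card hsub).trans Finset.card_biUnion_le

/-- The class `FSIAS` has a 0–1 law: for every first-order sentence in the
signature `{f, I, T}`, the fraction of labelled symmetric integral FAS
structures satisfying it tends either to 0 or to 1. -/
theorem stmt11 (σ : fasLang.Sentence) :
    Tendsto (fun n : ℕ =>
      (Nat.card {M : FASData n //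
        (IsFAS M ∧ FASSymmetric M ∧ FASIntegral M) ∧ SatSentence M σ} : ℝ) /
      (Nat.card {M : FASData n // IsFAS M ∧ FASSymmetric M ∧ FASIntegral M} : ℝ))
      atTop (𝓝 0) ∨
    Tendsto (fun n : ℕ =>
      (Nat.card {M : FASData n //
        (IsFAS M ∧ FASSymmetric M ∧ FASIntegral M) ∧ SatSentence M σ} : ℝ) /
      (Nat.card {M : FASData n // IsFAS M ∧ FASSymmetric M ∧ FASIntegral M} : ℝ))
      atTop (𝓝 1) := by
  classical
  have hΩ : ∀ n, Nat.card {M : FASData n // IsFAS M ∧ FASSymmetric M ∧ FASIntegral M} =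
      (fsias n).card := fun n => by
    rw [Nat.card_eq_fintype_card, Fintype.card_subtype]
    congr 1
    ext M
    simp [fsias, IsFSIAS]
  have hσ : ∀ n, Nat.card {M : FASData n //
      (IsFAS M ∧ FASSymmetric M ∧ FASIntegral M) ∧ SatSentence M σ} =
      ((fsias n).filter fun M => SatSentence M σ).card := fun n => by
    rw [Nat.card_eq_fintype_card, Fintype.card_subtype, fsias, Finset.filter_filter]
    congr 1
    ext M
    simp only [Finset.mem_filter, Finset.mem_univ, true_and]
    rfl
  simp only [hΩ, hσ]
  obtain ⟨k, hk⟩ := exists_realize_iff σ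
  have hk' : ∀ (n n' : ℕ) (M : FASData n) (N : FASData n'), IsFSIAS M → IsFSIAS N →
      (∀ j < k, HasExtension j M) → (∀ j < k, HasExtension j N) →
      (SatSentence M σ ↔ SatSentence N σ) := fun n n' M N hM hN eM eN =>
    hk n n' M N hM hN eM eN default default default default
      (diagram_eq_iff.2 ⟨fun i => i.elim0, fun i => i.elim0, fun i => i.elim0⟩)
  have hlim := tendsto_not_forall_hasExtension k
  by_cases h : ∃ (n : ℕ) (M : FASData n), IsFSIAS M ∧ (∀ j < k, HasExtension j M) ∧
      SatSentence M σ
  · obtain ⟨n₀, M₀, hM₀, eM₀, sM₀⟩ := h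
    right
    have hneg : Tendsto (fun n : ℕ => (((fsias n).filter fun M => ¬ SatSentence M σ).card : ℝ) /
        (fsias n).card) atTop (𝓝 0) := by
      refine squeeze_zero (fun n => by positivity) (fun n => ?_) hlim
      refine div_le_div_of_nonneg_right ?_ (Nat.cast_nonneg _)
      refine Nat.cast_le.2 (Finset.card_le_card fun N hN => ?_)
      rw [Finset.mem_filter] at hN ⊢
      exact ⟨hN.1, fun eN => hN.2 ((hk' _ _ M₀ N hM₀ (by simpa [fsias] using hN.1) eM₀ eN).1 sM₀)⟩
    have hsub := hneg.const_sub 1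
    rw [sub_zero] at hsub
    refine hsub.congr' ?_
    filter_upwards [eventually_gt_atTop 0] with n hn
    obtain ⟨M, hM⟩ := exists_isFSIAS hn
    have hpos : ((fsias n).card : ℝ) ≠ 0 := by
      rw [Nat.cast_ne_zero, Finset.card_ne_zero]
      exact ⟨M, by simpa [fsias] using hM⟩
    have hsplit : (((fsias n).filter fun M => SatSentence M σ).card : ℝ) +
        ((fsias n).filter fun M => ¬ SatSentence M σ).card = (fsias n).card := by
      exact_mod_cast Finset.card_filter_add_card_filter_not (s := fsias n)
        (fun M => SatSentence M σ)
    rw [eq_div_iff hpos, sub_mul, div_mul_cancel₀ _ hpos]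
    linarith
  · left
    refine squeeze_zero (fun n => by positivity) (fun n => ?_) hlim
    refine div_le_div_of_nonneg_right ?_ (Nat.cast_nonneg _)
    refine Nat.cast_le.2 (Finset.card_le_card fun N hN => ?_)
    rw [Finset.mem_filter] at hN ⊢
    exact ⟨hN.1, fun eN => h ⟨n, N, by simpa [fsias] using hN.1, eN, hN.2⟩⟩
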